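/- arXiv:1403.2777 — 2 statements merged into one kernel-verified Lean document; each statement's English description precedes it below -/
import Mathlib

section
/- Overflow Lemma: Let 0 ≤ ε ≤ 1 and let H be an ε-halver on pairs of binary arrays of length n. Let (A,B) be binary arrays of length n with t := ones(A) + ones(B) satisfying n < t ≤ 2n, and let (A',B') = H(A,B). Then ones(A') ≤ ε·n + (1−ε)·(t−n). Symmetrically, if z := zeros(A) + zeros(B) satisfies n < z ≤ 2n, then zeros(B') ≤ ε·n + (1−ε)·(z−n). -/
namespace ZZ

/-- A binary array of length `m` in the 0-1 model. -/
abbrev BArr (m : ℕ) := Fin m → Bool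

/-- The number of `true` (i.e. 1) entries of a binary array. -/
def ones {m : ℕ} (A : BArr m) : ℕ := (Finset.univ.filter (fun i => A i = true)).card

/-- The number of `false` (i.e. 0) entries of a binary array. -/
def zeros {m : ℕ} (A : BArr m) : ℕ := (Finset.univ.filter (fun i => A i = false)).card

/-- A map on pairs of binary arrays of length `m`. -/
abbrev PairMap (m : ℕ) := BArr m × BArr m → BArr m × BArr m

/-- The multiset of all `2m` entries of a pair of binary arrays. -/
def entries {m : ℕ} (P : BArr m × BArr m) : Multiset Bool :=
  Multiset.map P.1 Finset.univ.val + Multiset.map P.2 Finset.univ.val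

/-- `H` preserves the multiset of the `2m` entries. -/
def MultisetPreserving {m : ℕ} (H : PairMap m) : Prop :=
  ∀ P, entries (H P) = entries P

/-- `H` is an `ε`-halver. -/
def IsEpsHalver {m : ℕ} (ε : ℝ) (H : PairMap m) : Prop :=
  MultisetPreserving H ∧
  (∀ A B : BArr m, ones A + ones B ≤ m →
    (ones (H (A, B)).1 : ℝ) ≤ ε * ((ones A : ℝ) + (ones B : ℝ))) ∧
  (∀ A B : BArr m, zeros A + zeros B ≤ m →
    (zeros (H (A, B)).2 : ℝ) ≤ ε * ((zeros A : ℝ) + (zeros B : ℝ)))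

/-- `H` is an `(ε, lam)`-halver. -/
def IsLamHalver {m : ℕ} (ε lam : ℝ) (H : PairMap m) : Prop :=
  MultisetPreserving H ∧
  (∀ A B : BArr m, ((ones A : ℝ) + (ones B : ℝ)) ≤ lam * m →
    (ones (H (A, B)).1 : ℝ) ≤ ε * ((ones A : ℝ) + (ones B : ℝ))) ∧
  (∀ A B : BArr m, ((zeros A : ℝ) + (zeros B : ℝ)) ≤ lam * m →
    (zeros (H (A, B)).2 : ℝ) ≤ ε * ((zeros A : ℝ) + (zeros B : ℝ)))

/-- `H` is a `(δ, lam)`-attenuator. -/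
def IsAttenuator {m : ℕ} (δ lam : ℝ) (H : PairMap m) : Prop :=
  MultisetPreserving H ∧
  (∀ A B : BArr m, ((ones A : ℝ) + (ones B : ℝ)) ≤ lam * m →
    (ones (H (A, B)).1 : ℝ) ≤ δ * (ones A : ℝ)) ∧
  (∀ A B : BArr m, ((zeros A : ℝ) + (zeros B : ℝ)) ≤ lam * m →
    (zeros (H (A, B)).2 : ℝ) ≤ δ * (zeros B : ℝ))

theorem ones_add_zeros {m : ℕ} (A : BArr m) : ones A + zeros A = m := by
  simpa [ones, zeros] using
    Finset.card_filter_add_card_filter_not (s := Finset.univ) (fun i => A i = true)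

theorem count_true_entries {m : ℕ} (P : BArr m × BArr m) :
    (entries P).count true = ones P.1 + ones P.2 := by
  simp only [entries, ones, Multiset.count_add, Multiset.count_map, eq_comm (a := true)]
  rfl

theorem MultisetPreserving.ones_add_ones {m : ℕ} {H : PairMap m} (hH : MultisetPreserving H)
    (A B : BArr m) : ones (H (A, B)).1 + ones (H (A, B)).2 = ones A + ones B := by
  rw [← count_true_entries, hH, count_true_entries]

/-- **Overflow Lemma.**  If an `ε`-halver (with `0 ≤ ε ≤ 1`) is applied to binary
arrays `A` and `B` of size `n` each, and `t := ones A + ones B` satisfies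
`n < t ≤ 2n`, then at most `ε·n + (1-ε)·(t-n)` ones remain in the first output
array; symmetrically for zeros in the second output array. -/
theorem overflow_lemma {n : ℕ} (ε : ℝ) (hε0 : 0 ≤ ε) (hε1 : ε ≤ 1)
    (H : PairMap n) (hH : IsEpsHalver ε H) (A B : BArr n) :
    (n < ones A + ones B → ones A + ones B ≤ 2 * n →
      (ones (H (A, B)).1 : ℝ) ≤ ε * n + (1 - ε) * (((ones A : ℝ) + (ones B : ℝ)) - n)) ∧
    (n < zeros A + zeros B → zeros A + zeros B ≤ 2 * n →
      (zeros (H (A, B)).2 : ℝ) ≤ ε * n + (1 - ε) * (((zeros A : ℝ) + (zeros B : ℝ)) - n)) := by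
  obtain ⟨hpres, hones, hzeros⟩ := hH
  have hsum := hpres.ones_add_ones A B
  have hA := ones_add_zeros A
  have hB := ones_add_zeros B
  have hA' := ones_add_zeros (H (A, B)).1
  have hB' := ones_add_zeros (H (A, B)).2
  constructor
  · intro ht _
    have h := hzeros A B (by omega)
    rify at *
    rw [show (zeros A : ℝ) + zeros B = 2 * n - (ones A + ones B) by linarith] at h
    linarith
  · intro hz _
    have h := hones A B (by omega)
    rify at *
    rw [show (ones A : ℝ) + ones B = 2 * n - (zeros A + zeros B) by linarith] at h
    linarith

end ZZ
end

section
/- The Claim in the attenuator theorem: Assume α ≤ 1/6. Let n > 8 be a power of two and let (A,B) be binary arrays of length n with k := ones(A)+ones(B) ≤ (5/6)·n. Apply Halver_n to (A,B), obtaining (A*,B*); split A* into halves A*₁, A*₂ and B* into halves B*₁, B*₂; apply Halver_{n/2} to (A*₁,A*₂), then to (B*₁,B*₂), then to (A*₂,B*₁). Then the pair passed to the first recursive call of Attenuate satisfies ones(A*₂) + ones(B*₁) ≤ 5n/12 (that is, at most 5/6 of the per-array size n/2). -/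
namespace ZZ

theorem pow_split (k : ℕ) : (2:ℕ)^(k+1) = 2^k + 2^k := by
  rw [pow_succ, mul_two]

/-- The first half of a binary array of even length. -/
def fh {m n : ℕ} (h : n = m + m) (A : BArr n) : BArr m :=
  fun i => A ⟨i.1, by have := i.2; omega⟩

/-- The second half of a binary array of even length. -/
def sh {m n : ℕ} (h : n = m + m) (A : BArr n) : BArr m :=
  fun i => A ⟨m + i.1, by have := i.2; omega⟩

/-- Concatenation of two halves. -/
def glue {m n : ℕ} (h : n = m + m) (A B : BArr m) : BArr n :=
  fun i => if hi : i.1 < m then A ⟨i.1, hi⟩ else B ⟨i.1 - m, by have := i.2; omega⟩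

/-- Replace the `2m` entries of the pair by their sorted order
(all `false` entries first, across the first array followed by the second). -/
def sortedPair {m : ℕ} (P : BArr m × BArr m) : BArr m × BArr m :=
  (fun i => decide (zeros P.1 + zeros P.2 ≤ i.1),
   fun i => decide (zeros P.1 + zeros P.2 ≤ m + i.1))

/-- The `Attenuate` algorithm, built from a family of halvers indexed by the
exponent of the (power of two) array length. -/
def Attenuate (Halver : ∀ k : ℕ, PairMap (2^k)) : ∀ k : ℕ, PairMap (2^k)
  | 0 => sortedPair
  | 1 => sortedPair
  | 2 => sortedPair
  | 3 => sortedPair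
  | k+4 => fun P =>
      let pA := Halver (k+3) (fh (pow_split (k+3)) P.1, sh (pow_split (k+3)) P.1)
      let pB := Halver (k+3) (fh (pow_split (k+3)) P.2, sh (pow_split (k+3)) P.2)
      let pM := Attenuate Halver (k+3) (Halver (k+3) (pA.2, pB.1))
      let qA := Halver (k+2) (fh (pow_split (k+2)) pM.1, sh (pow_split (k+2)) pM.1)
      let qB := Halver (k+2) (fh (pow_split (k+2)) pM.2, sh (pow_split (k+2)) pM.2)
      let qM := Attenuate Halver (k+2) (Halver (k+2) (qA.2, qB.1))
      (glue (pow_split (k+3)) pA.1 (glue (pow_split (k+2)) qA.1 qM.1),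
       glue (pow_split (k+3)) (glue (pow_split (k+2)) qM.2 qB.2) pB.2)

/-- The `Reduce` algorithm. -/
def Reduce (Halver : ∀ k : ℕ, PairMap (2^k)) : ∀ k : ℕ, PairMap (2^k)
  | 0 => sortedPair
  | 1 => sortedPair
  | 2 => sortedPair
  | 3 => sortedPair
  | k+4 => fun P => Attenuate Halver (k+4) (Halver (k+4) P)

theorem ones_eq_count {m : ℕ} (A : BArr m) :
    ones A = Multiset.count true (Multiset.map A Finset.univ.val) := by
  rw [Multiset.count_map, ones, Finset.card_def, Finset.filter_val]
  simp only [eq_comm]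

theorem ones_fh_add_ones_sh {m n : ℕ} (h : n = m + m) (A : BArr n) :
    ones (fh h A) + ones (sh h A) = ones A := by
  subst h
  simp only [ones, Finset.card_filter, Fin.sum_univ_add]
  rfl

/-- **The Claim in the attenuator theorem.**  Let `n = 2^(k+4) > 8` be a power of
two and suppose `ones A + ones B ≤ (5/6)·n`.  Apply `Halver` to `(A, B)`, split
the results into halves, and apply `Halver` to `(A₁, A₂)`, `(B₁, B₂)`, and
`(A₂, B₁)` as in `Attenuate`.  Then the pair passed to the first recursive call
of `Attenuate` holds at most `5n/12` ones. -/
theorem attenuate_first_call_claim (α : ℝ) (hα0 : 0 ≤ α) (hα : α ≤ 1/6)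
    (Halver : ∀ k : ℕ, PairMap (2 ^ k)) (hH : ∀ k, IsEpsHalver α (Halver k))
    (k : ℕ) (A B : BArr (2 ^ (k + 4)))
    (hones : ((ones A : ℝ) + (ones B : ℝ)) ≤ (5/6) * (2 ^ (k + 4) : ℝ)) :
    ((ones ((Halver (k+3)
        ((Halver (k+3) (fh (pow_split (k+3)) (Halver (k+4) (A, B)).1,
                        sh (pow_split (k+3)) (Halver (k+4) (A, B)).1)).2,
         (Halver (k+3) (fh (pow_split (k+3)) (Halver (k+4) (A, B)).2,
                        sh (pow_split (k+3)) (Halver (k+4) (A, B)).2)).1))).1 : ℝ) +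
     (ones ((Halver (k+3)
        ((Halver (k+3) (fh (pow_split (k+3)) (Halver (k+4) (A, B)).1,
                        sh (pow_split (k+3)) (Halver (k+4) (A, B)).1)).2,
         (Halver (k+3) (fh (pow_split (k+3)) (Halver (k+4) (A, B)).2,
                        sh (pow_split (k+3)) (Halver (k+4) (A, B)).2)).1))).2 : ℝ))
      ≤ 5 * (2 ^ (k + 4) : ℝ) / 12 := by
  have e : (2 : ℝ) ^ (k + 4) = 2 ^ (k + 3) + 2 ^ (k + 3) := mod_cast pow_split (k + 3)
  obtain ⟨hP, hO, -⟩ := hH (k + 4)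
  obtain ⟨hp, ho, hz⟩ := hH (k + 3)
  have hpos : (0 : ℝ) < 2 ^ (k + 3) := by positivity
  have hAB : ones A + ones B ≤ 2 ^ (k + 4) := by
    have : ((ones A : ℝ) + ones B) ≤ 2 ^ (k + 4) := by linarith
    exact_mod_cast this
  have hsum := hP.ones_add_ones A B
  have hfirst := hO A B hAB
  generalize Halver (k + 4) (A, B) = S at *
  have hsumR : (ones S.1 : ℝ) + ones S.2 = ones A + ones B := mod_cast hsum
  have hA := hp.ones_add_ones (fh (pow_split (k+3)) S.1) (sh (pow_split (k+3)) S.1)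
  rw [ones_fh_add_ones_sh] at hA
  have hB := hp.ones_add_ones (fh (pow_split (k+3)) S.2) (sh (pow_split (k+3)) S.2)
  have hBsplit := ones_fh_add_ones_sh (pow_split (k+3)) S.2
  have hfz := ones_add_zeros (fh (pow_split (k+3)) S.2)
  have hsz := ones_add_zeros (sh (pow_split (k+3)) S.2)
  have hBo := ho (fh (pow_split (k+3)) S.2) (sh (pow_split (k+3)) S.2)
  have hBz := hz (fh (pow_split (k+3)) S.2) (sh (pow_split (k+3)) S.2)
  generalize Halver (k + 3) (fh (pow_split (k+3)) S.1, sh (pow_split (k+3)) S.1) = P at *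
  generalize Halver (k + 3) (fh (pow_split (k+3)) S.2, sh (pow_split (k+3)) S.2) = Q at *
  have hPQ : (ones (Halver (k+3) (P.2, Q.1)).1 : ℝ) + ones (Halver (k+3) (P.2, Q.1)).2
      = ones P.2 + ones Q.1 := mod_cast hp.ones_add_ones P.2 Q.1
  rw [hPQ]
  have hQz := ones_add_zeros Q.2
  generalize fh (pow_split (k+3)) S.2 = F at *
  generalize sh (pow_split (k+3)) S.2 = G at *
  have hle (x : ℝ) (hx : 0 ≤ x) : α * x ≤ x / 6 := by nlinarith
  have hfirst' := hfirst.trans (hle _ (by positivity))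
  have hA' : (ones P.1 : ℝ) + ones P.2 = ones S.1 := mod_cast hA
  have hP1 : (0 : ℝ) ≤ ones P.1 := by positivity
  have hFG : (ones F : ℝ) + ones G = ones S.2 := mod_cast hBsplit
  rcases le_total (ones F + ones G) (2 ^ (k + 3)) with hb | hb
  · have hQ := (hBo hb).trans (hle _ (by positivity))
    linarith
  · have hQ := (hBz (by omega)).trans (hle _ (by positivity))
    have hB' : (ones Q.1 : ℝ) + ones Q.2 = ones F + ones G := mod_cast hB
    have hQz' : (ones Q.2 : ℝ) + zeros Q.2 = 2 ^ (k + 3) := mod_cast hQz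
    have hfz' : (ones F : ℝ) + zeros F = 2 ^ (k + 3) := mod_cast hfz
    have hsz' : (ones G : ℝ) + zeros G = 2 ^ (k + 3) := mod_cast hsz
    have hb' : (2 : ℝ) ^ (k + 3) ≤ ones F + ones G := mod_cast hb
    linarith

end ZZ
end
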